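/- For every ε > 0 there is a constant C_ε such that for every nonzero q ∈ ℤ[i] and every x ∈ ℤ[i]: |Σ_{r ∈ 𝔸_{q̄}} τ_q(x + r)| ≤ C_ε · N(gcd(x̄, q)) · N(q)^ε. -/

import Mathlib

open Complex GaussianInt MeasureTheory
open scoped Real ENNReal

noncomputable section
attribute [local instance] Classical.propDecidable

/-- The real inner product on `ℂ ≅ ℝ²`: `⟨z, w⟩ = Re z · Re w + Im z · Im w`. -/
def cip (z w : ℂ) : ℝ := z.re * w.re + z.im * w.im

/-- `e(t) = exp(2πit)`. -/
def e2 (t : ℝ) : ℂ := Complex.exp (2 * Real.pi * Complex.I * t)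

/-- The fundamental box `B_q` of residues modulo `q`:
`B_q = {r : 0 ≤ ⟨r,q⟩ < N(q), 0 ≤ ⟨r,iq⟩ < N(q)}`. -/
def Bq (q : GaussianInt) : Set GaussianInt :=
  {r | 0 ≤ cip (toComplex r) (toComplex q) ∧
       cip (toComplex r) (toComplex q) < Complex.normSq (toComplex q) ∧
       0 ≤ cip (toComplex r) (Complex.I * toComplex q) ∧
       cip (toComplex r) (Complex.I * toComplex q) < Complex.normSq (toComplex q)}

/-- `𝔸_q`, the reduced residues in `B_q` (gcd with `q` a unit). -/
def Aq (q : GaussianInt) : Set GaussianInt :=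
  {r | r ∈ Bq q ∧ IsUnit (EuclideanDomain.gcd r q)}

/-- The Euler totient on `ℤ[i]`: `φ(q) = |𝔸_q|`. -/
def gphi (q : GaussianInt) : ℕ := Nat.card (Aq q)

/-- The Gaussian Ramanujan sum `τ_q(x) = Σ_{n ∈ 𝔸_q} e(⟨x, n/q⟩)`. -/
def gtau (q x : GaussianInt) : ℂ :=
  ∑' n : Aq q, e2 (cip (toComplex x) (toComplex (n : GaussianInt) / toComplex q))

/-- The Möbius function on `ℤ[i]`: `(-1)^k` on squarefree numbers with `k`
pairwise non-associate prime factors (so `1` on units), and `0` otherwise. -/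
def gmu (n : GaussianInt) : ℤ :=
  if n ≠ 0 ∧ Squarefree n then (-1) ^ (UniqueFactorizationMonoid.factors n).card else 0

/-- The von Mangoldt function on `ℤ[i]`: `Λ(n) = log N(ρ)` if `n` is a unit times
`ρ^k` for a Gaussian prime `ρ` and `k ≥ 1`, and `0` otherwise. -/
def gvm (n : GaussianInt) : ℝ :=
  if h : ∃ ρ : GaussianInt, Irreducible ρ ∧
      ∃ k : ℕ, 1 ≤ k ∧ ∃ u : GaussianInt, IsUnit u ∧ n = u * ρ ^ k
  then Real.log (Complex.normSq (toComplex h.choose)) else 0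

/-- `ω ⊆ 𝕋 = ℝ/2πℤ` is an interval (arc) of length `l`. -/
def IsArc (ω : Set Real.Angle) (l : ℝ) : Prop :=
  ∃ a : ℝ, ω = (fun θ : ℝ => (θ : Real.Angle)) '' Set.Ico a (a + l)

/-- `arg z ∈ ω`, as a condition in `𝕋`. -/
def argIn (z : ℂ) (ω : Set Real.Angle) : Prop := (↑(Complex.arg z) : Real.Angle) ∈ ω

/-- The normalized sector average kernel `M_N^ω`. -/
def Msec (ω : Set Real.Angle) (l : ℝ) (N : ℕ) (n : GaussianInt) : ℝ :=
  if Zsqrtd.norm n < (N : ℤ) ∧ argIn (toComplex n) ω then 2 * Real.pi / (l * N) else 0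

/-- The weighted sector average kernel `A_N^ω` (with von Mangoldt weights). -/
def Asec (ω : Set Real.Angle) (l : ℝ) (N : ℕ) (n : GaussianInt) : ℂ :=
  if Zsqrtd.norm n < (N : ℤ) ∧ argIn (toComplex n) ω then
    ((2 * Real.pi / (l * N) : ℝ) : ℂ) * (gvm n : ℂ) else 0

/-- The canonical representative of a nonzero associate class in `ℤ[i]`. -/
def IsCanon (z : GaussianInt) : Prop := 0 < z.re ∧ 0 ≤ z.im

/-- `Φ(a, q) = τ_q(a)/φ(q)`. -/
def Phi (a q : GaussianInt) : ℂ := gtau q a / (gphi q : ℂ)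

/-- `Â_N^ω(α)`: the Fourier transform of the weighted sector average. -/
def Ahat (ω : Set Real.Angle) (l : ℝ) (N : ℕ) (α : ℂ) : ℂ :=
  ((2 * Real.pi / (l * N) : ℝ) : ℂ) *
    ∑' n : {m : GaussianInt // Zsqrtd.norm m < (N : ℤ) ∧ argIn (toComplex m) ω},
      (gvm (n : GaussianInt) : ℂ) * e2 (cip (toComplex (n : GaussianInt)) α)

/-- `M̂_N^ω(β)`: the Fourier transform of the sector average. -/
def Mhat (ω : Set Real.Angle) (l : ℝ) (N : ℕ) (β : ℂ) : ℂ :=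
  ((2 * Real.pi / (l * N) : ℝ) : ℂ) *
    ∑' n : {m : GaussianInt // Zsqrtd.norm m < (N : ℤ) ∧ argIn (toComplex m) ω},
      e2 (cip (toComplex (n : GaussianInt)) β)

/-- The tensor Fejér-type bump `η(ξ₁+iξ₂) = (1-|ξ₁|)₊ (1-|ξ₂|)₊`. -/
def eta (ξ : ℂ) : ℝ := max 0 (1 - |ξ.re|) * max 0 (1 - |ξ.im|)

/-- `Δ_s(ξ) = η(16^s ξ)`. -/
def Delta (s : ℕ) (ξ : ℂ) : ℝ := eta ((16 : ℂ) ^ s * ξ)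

/-- `Δ̌_{q₀}(n) = ∫_{[-1/2,1/2)²} Δ_{q₀}(ξ) e(⟨n, ξ⟩) dξ`. -/
def DeltaCheck (q₀ : ℕ) (n : GaussianInt) : ℂ :=
  ∫ p in (Set.Ico (-(1:ℝ)/2) (1/2)) ×ˢ (Set.Ico (-(1:ℝ)/2) (1/2)),
    ((Delta q₀ ((p.1 : ℂ) + (p.2 : ℂ) * Complex.I) : ℝ) : ℂ) *
      e2 (cip (toComplex n) ((p.1 : ℂ) + (p.2 : ℂ) * Complex.I))

/-- The Low part `Lo_{Q,N}^ω` with `Q = 2^{q₀}`. -/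
def Lo (ω : Set Real.Angle) (l : ℝ) (N : ℕ) (q₀ : ℕ) (x : GaussianInt) : ℂ :=
  (∑' y : GaussianInt, ((Msec ω l N y : ℝ) : ℂ) * DeltaCheck q₀ (x - y)) *
    ∑' q : {q : GaussianInt // IsCanon q ∧ (Zsqrtd.norm q : ℝ) < 2 ^ q₀},
      ∑' a : Aq (q : GaussianInt),
        Phi (a : GaussianInt) (star (q : GaussianInt)) *
          e2 (cip (toComplex x) (toComplex (a : GaussianInt) / toComplex (q : GaussianInt)))

/-- Distance from `β ∈ ℂ` to the nearest Gaussian integer. -/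
def distZi (β : ℂ) : ℝ := Metric.infDist β (Set.range fun n : GaussianInt => toComplex n)

/-- `q` is `Q`-smooth: squarefree with all prime factors of norm at most `Q`. -/
def QSmooth (Q : ℝ) (q : GaussianInt) : Prop :=
  Squarefree q ∧ ∀ ρ : GaussianInt, Irreducible ρ → ρ ∣ q → (Zsqrtd.norm ρ : ℝ) ≤ Q


/-- The sum of a function over the units of a finite monoid, as a sum over the whole monoid. -/
lemma sum_units_eq_sum_ite {R : Type*} [Monoid R] [Fintype R] (f : R → ℂ) :
    ∑ u : Rˣ, f u = ∑ r : R, if IsUnit r then f r else 0 := by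
  rw [← Finset.sum_filter]
  refine Finset.sum_bij (fun u _ => (u : R)) ?_ ?_ ?_ ?_
  · intro u _; simp
  · intro u _ v _ h; exact Units.ext h
  · intro r hr
    obtain ⟨u, rfl⟩ := (Finset.mem_filter.1 hr).2
    exact ⟨u, Finset.mem_univ _, rfl⟩
  · intro u _; rfl

/-- Over a finite group, the sum of an additive character over the nonzero elements is bounded by
the size of the group if the character is trivial, and by `1` otherwise. -/
lemma norm_sum_ne_zero_addChar_le {F : Type*} [AddGroup F] [Fintype F] (χ : AddChar F ℂ) :
    ‖∑ y : F, if y = 0 then 0 else χ y‖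
      ≤ ((if χ = 0 then Finset.univ else {0} : Finset F).card : ℝ) := by
  have key : (∑ y : F, if y = 0 then 0 else χ y) = (∑ y, χ y) - 1 := by
    rw [eq_sub_iff_add_eq]
    have : (1 : ℂ) = ∑ y : F, if y = 0 then χ y else 0 := by simp
    rw [this, ← Finset.sum_add_distrib]
    refine Finset.sum_congr rfl fun y _ => ?_
    split_ifs <;> simp
  rw [key, AddChar.sum_eq_ite]
  split_ifs with h
  · have : (1 : ℝ) ≤ Fintype.card F := by exact_mod_cast Fintype.card_pos
    have e : ((Fintype.card F : ℂ) - 1) = (((Fintype.card F : ℝ) - 1 : ℝ) : ℂ) := by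
      push_cast; rfl
    rw [e, Complex.norm_real, Real.norm_of_nonneg (by linarith)]
    simp
  · simp

/-- The additive character bound for a finite product of finite fields. -/
lemma norm_sum_isUnit_pi_le {ι : Type*} [Fintype ι] {F : ι → Type*} [∀ i, CommRing (F i)]
    [∀ i, Fintype (F i)] (hF : ∀ i, ∀ y : F i, IsUnit y ↔ y ≠ 0) (χ : AddChar (∀ i, F i) ℂ) :
    ‖∑ s : ∀ i, F i, if IsUnit s then χ s else 0‖
      ≤ (Nat.card {a : ∀ i, F i // ∀ b, χ (a * b) = 1} : ℝ) := by
  let χi : ∀ i, AddChar (F i) ℂ := fun i => χ.compAddMonoidHom (AddMonoidHom.single F i)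
  have hχ : ∀ s, χ s = ∏ i, χi i (s i) := by
    intro s
    conv_lhs => rw [← Finset.univ_sum_single s]
    exact map_prod χ.toMonoidHom (fun i => Multiplicative.ofAdd (Pi.single i (s i))) _
  have h1 : (∑ s : ∀ i, F i, if IsUnit s then χ s else 0)
      = ∏ i, ∑ y : F i, if y = 0 then 0 else χi i y := by
    rw [Finset.prod_univ_sum, Fintype.piFinset_univ]
    refine Finset.sum_congr rfl fun s _ => ?_
    split_ifs with hs
    · rw [hχ]
      refine Finset.prod_congr rfl fun i _ => ?_
      rw [if_neg ((hF i _).1 (Pi.isUnit_iff.1 hs i))]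
    · rw [Pi.isUnit_iff, not_forall] at hs
      obtain ⟨i, hi⟩ := hs
      rw [hF, not_not] at hi
      exact (Finset.prod_eq_zero (Finset.mem_univ i) (by simp [hi])).symm
  rw [h1, norm_prod]
  refine (Finset.prod_le_prod (fun i _ => _root_.norm_nonneg _)
    (fun i _ => norm_sum_ne_zero_addChar_le (χi i))).trans ?_
  rw [← Nat.cast_prod, ← Fintype.card_piFinset, Nat.card_eq_fintype_card, Fintype.card_subtype]
  refine Nat.cast_le.2 (Finset.card_le_card fun a ha => ?_)
  rw [Fintype.mem_piFinset] at ha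
  refine Finset.mem_filter.2 ⟨Finset.mem_univ _, fun b => ?_⟩
  rw [hχ]
  refine Finset.prod_eq_one fun i _ => ?_
  have := ha i
  split_ifs at this with h
  · rw [h]; rfl
  · simp [Finset.mem_singleton.1 this]

/-- An element of a commutative ring is a unit if and only if its image in every
residue field is a unit. -/
lemma isUnit_iff_forall_quotient_maximal {R : Type*} [CommRing R] (r : R) :
    IsUnit r ↔ ∀ I : MaximalSpectrum R, IsUnit (Ideal.Quotient.mk I.asIdeal r) := by
  refine ⟨fun h I => h.map _, fun h => ?_⟩
  by_contra hr
  obtain ⟨M, hM, hrM⟩ := exists_max_ideal_of_mem_nonunits hr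
  have := h ⟨M, hM⟩
  rw [Ideal.Quotient.eq_zero_iff_mem.2 hrM] at this
  have : Nontrivial (R ⧸ M) := Ideal.Quotient.nontrivial_iff.2 hM.ne_top
  exact not_isUnit_zero ‹IsUnit _›

/-- An additive character that is trivial on the kernel of a surjective homomorphism factors through
it. -/
lemma exists_addChar_lift_of_surjective {G H : Type*} [AddGroup G] [AddGroup H] (φ : G →+ H)
    (hφ : Function.Surjective φ) (χ : AddChar G ℂ) (hχ : ∀ j, φ j = 0 → χ j = 1) :
    ∃ χ' : AddChar H ℂ, ∀ g, χ g = χ' (φ g) := by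
  have hlift : ∀ r r', φ r = φ r' → χ r = χ r' := by
    intro r r' h
    have h1 := hχ (r - r') (by rw [map_sub, h, sub_self])
    have h2 : χ r = χ (r - r') * χ r' := by rw [← AddChar.map_add_eq_mul, sub_add_cancel]
    rw [h2, h1, one_mul]
  let σ := Function.surjInv hφ
  have hσ : ∀ s, φ (σ s) = s := Function.surjInv_eq hφ
  exact ⟨{ toFun := fun s => χ (σ s)
           map_zero_eq_one' := hχ _ (hσ 0)
           map_add_eq_mul' := fun a b => by
            rw [← AddChar.map_add_eq_mul]
            exact hlift _ _ (by rw [map_add, hσ, hσ, hσ]) },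
    fun r => hlift _ _ (hσ _).symm⟩

/-- Transfer of the additive character bound along a surjective ring homomorphism that reflects
units. -/
lemma norm_sum_isUnit_le_of_surjective {R S : Type*} [CommRing R] [Fintype R] [CommRing S]
    [Fintype S] (φ : R →+* S) (hφ : Function.Surjective φ) (hu : ∀ r, IsUnit r ↔ IsUnit (φ r))
    (hS : ∀ χ : AddChar S ℂ, ‖∑ s : S, if IsUnit s then χ s else 0‖
      ≤ (Nat.card {a : S // ∀ b, χ (a * b) = 1} : ℝ)) (χ : AddChar R ℂ) :
    ‖∑ r : R, if IsUnit r then χ r else 0‖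
      ≤ (Nat.card {a : R // ∀ b, χ (a * b) = 1} : ℝ) := by
  by_cases htriv : ∀ j, φ j = 0 → χ j = 1
  · obtain ⟨χ', hχ'⟩ := exists_addChar_lift_of_surjective φ.toAddMonoidHom hφ χ htriv
    replace hχ' : ∀ r, χ r = χ' (φ r) := hχ'
    have hfib : ∀ s, (Finset.card {r : R | φ r = s}) = Finset.card {r : R | φ r = 0} := fun s =>
      AddMonoidHom.card_fiber_eq_of_mem_range φ.toAddMonoidHom (hφ s) (hφ 0)
    have hsum : ∀ g : S → ℂ, ∑ r, g (φ r) = (Finset.card {r : R | φ r = 0} : ℂ) * ∑ s, g s := by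
      intro g
      rw [Finset.sum_comp, Finset.image_univ_of_surjective hφ, Finset.mul_sum]
      refine Finset.sum_congr rfl fun s _ => ?_
      rw [hfib, nsmul_eq_mul]
    have hL : (∑ r : R, if IsUnit r then χ r else 0)
        = (Finset.card {r : R | φ r = 0} : ℂ) * ∑ s : S, if IsUnit s then χ' s else 0 := by
      rw [← hsum]
      refine Finset.sum_congr rfl fun r _ => ?_
      simp only [hu r, hχ' r]
    have hC : Nat.card {a : R // ∀ b, χ (a * b) = 1}
        = Finset.card {r : R | φ r = 0} * Nat.card {a : S // ∀ b, χ' (a * b) = 1} := by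
      simp only [Nat.card_eq_fintype_card, Fintype.card_subtype]
      have := hsum (fun a => if ∀ b, χ' (a * b) = 1 then 1 else 0)
      rw [Finset.sum_boole, Finset.sum_boole] at this
      have h3 : ∀ a : R, (∀ b, χ (a * b) = 1) ↔ ∀ b, χ' (φ a * b) = 1 := by
        intro a
        rw [hφ.forall]
        simp only [hχ', map_mul]
      simp only [h3]
      exact_mod_cast this
    rw [hL, hC, norm_mul, Nat.cast_mul, Complex.norm_natCast]
    exact mul_le_mul_of_nonneg_left (hS χ') (Nat.cast_nonneg _)
  · push Not at htriv
    obtain ⟨j, hj, hne⟩ := htriv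
    have : (∑ r : R, if IsUnit r then χ r else 0) = 0 := by
      refine eq_zero_of_mul_eq_self_left hne ?_
      rw [Finset.mul_sum]
      refine Fintype.sum_equiv (Equiv.addLeft j) _ _ fun r => ?_
      have h4 : IsUnit (j + r) ↔ IsUnit r := by rw [hu, hu r, map_add, hj, zero_add]
      simp only [Equiv.coe_addLeft, h4, AddChar.map_add_eq_mul, mul_ite, mul_zero]
    rw [this, norm_zero]
    exact Nat.cast_nonneg _

/-- The sum of an additive character of a finite commutative ring over the units is bounded by the
size of the largest ideal on which the character is trivial. -/
theorem norm_sum_units_addChar_le {R : Type*} [CommRing R] [Fintype R] (χ : AddChar R ℂ) :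
    ‖∑ u : Rˣ, χ u‖ ≤ (Nat.card {a : R // ∀ b, χ (a * b) = 1} : ℝ) := by
  let : Fintype (MaximalSpectrum R) := Fintype.ofFinite _
  let : ∀ I : MaximalSpectrum R, Fintype (R ⧸ I.asIdeal) := fun I => Fintype.ofFinite _
  let φ : R →+* ∀ I : MaximalSpectrum R, R ⧸ I.asIdeal :=
    RingHom.pi fun I => Ideal.Quotient.mk I.asIdeal
  have hcop : Pairwise fun I J : MaximalSpectrum R => IsCoprime I.asIdeal J.asIdeal := by
    intro I J hIJ
    have := I.isMaximal
    have := J.isMaximal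
    exact Ideal.isCoprime_of_isMaximal fun h => hIJ (MaximalSpectrum.ext h)
  have hφ : Function.Surjective φ := by
    intro s
    obtain ⟨r, hr⟩ := Ideal.pi_quotient_surjective hcop s
    exact ⟨r, funext hr⟩
  have hu : ∀ r, IsUnit r ↔ IsUnit (φ r) := by
    intro r
    rw [isUnit_iff_forall_quotient_maximal, Pi.isUnit_iff]
    rfl
  have hF : ∀ I : MaximalSpectrum R, ∀ y : R ⧸ I.asIdeal, IsUnit y ↔ y ≠ 0 := by
    intro I y
    have := I.isMaximal
    let := Ideal.Quotient.field I.asIdeal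
    exact isUnit_iff_ne_zero
  rw [sum_units_eq_sum_ite (fun r => χ r)]
  refine norm_sum_isUnit_le_of_surjective φ hφ hu (fun χ => ?_) χ
  convert norm_sum_isUnit_pi_le hF χ

/-- The `ℤ`-basis `1, i` of the Gaussian integers. -/
def gaussianBasis : Module.Basis (Fin 2) ℤ GaussianInt :=
  Module.Basis.ofEquivFun
    { toFun := fun z => ![z.re, z.im]
      invFun := fun v => ⟨v 0, v 1⟩
      left_inv := fun z => by ext <;> simp
      right_inv := fun v => by ext i; fin_cases i <;> simp
      map_add' := fun z w => by ext i; fin_cases i <;> simp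
      map_smul' := fun c z => by ext i; fin_cases i <;> simp }

lemma gaussianBasis_repr (z : GaussianInt) (i : Fin 2) :
    gaussianBasis.repr z i = ![z.re, z.im] i := rfl

lemma gaussianBasis_zero : gaussianBasis 0 = 1 := by
  apply gaussianBasis.repr.injective
  ext i
  rw [gaussianBasis.repr_self, gaussianBasis_repr]
  fin_cases i <;> simp

lemma gaussianBasis_one : gaussianBasis 1 = ⟨0, 1⟩ := by
  apply gaussianBasis.repr.injective
  ext i
  rw [gaussianBasis.repr_self, gaussianBasis_repr]
  fin_cases i <;> simp

lemma algebraNorm_gaussianInt (z : GaussianInt) : Algebra.norm ℤ z = Zsqrtd.norm z := by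
  rw [Algebra.norm_eq_matrix_det gaussianBasis, Matrix.det_fin_two]
  simp only [Algebra.leftMulMatrix_eq_repr_mul, gaussianBasis_repr, gaussianBasis_zero,
    gaussianBasis_one, Zsqrtd.norm_def]
  simp

lemma finite_quotient_span_gaussianInt {q : GaussianInt} (hq : q ≠ 0) :
    Finite (GaussianInt ⧸ Ideal.span {q}) := by
  have := Module.Free.of_basis gaussianBasis
  have := Module.Finite.of_basis gaussianBasis
  exact Ideal.finiteQuotientOfFreeOfNeBot _ (by simpa using hq)

lemma card_quotient_span_gaussianInt (q : GaussianInt) :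
    (Nat.card (GaussianInt ⧸ Ideal.span {q}) : ℤ) = Zsqrtd.norm q := by
  have := Module.Free.of_basis gaussianBasis
  have := Module.Finite.of_basis gaussianBasis
  have h := Ideal.absNorm_span_singleton q
  rw [algebraNorm_gaussianInt, Ideal.absNorm_apply, Submodule.cardQuot_apply] at h
  rw [h, Int.natAbs_of_nonneg (GaussianInt.norm_nonneg q)]

lemma card_annihilator_le {q : GaussianInt} (hq : q ≠ 0) (y : GaussianInt) :
    (Nat.card {a : GaussianInt ⧸ Ideal.span {q} // Ideal.Quotient.mk _ y * a = 0} : ℤ)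
      ≤ Zsqrtd.norm (EuclideanDomain.gcd y q) := by
  set g := EuclideanDomain.gcd y q with hg
  have hg0 : g ≠ 0 := fun h => hq (EuclideanDomain.gcd_eq_zero_iff.1 h).2
  obtain ⟨q', hq'⟩ : g ∣ q := EuclideanDomain.gcd_dvd_right y q
  rw [← card_quotient_span_gaussianInt]
  have := finite_quotient_span_gaussianInt hg0
  have := finite_quotient_span_gaussianInt hq
  let f : GaussianInt ⧸ Ideal.span {g} → GaussianInt ⧸ Ideal.span {q} :=
    fun c => Ideal.Quotient.mk _ (q' * c.out)
  refine Nat.cast_le.2 ?_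
  refine (Nat.card_mono (Set.finite_range f) (s := {a | Ideal.Quotient.mk _ y * a = 0}) ?_).trans
    (Finite.card_range_le f)
  intro a ha
  obtain ⟨z, rfl⟩ := Ideal.Quotient.mk_surjective a
  rw [Set.mem_ofPred_eq, ← map_mul, Ideal.Quotient.eq_zero_iff_mem, Ideal.mem_span_singleton] at ha
  have h1 : q ∣ g * z := by
    rw [hg, EuclideanDomain.gcd_eq_gcd_ab y q, add_mul]
    refine dvd_add ?_ (by rw [mul_assoc]; exact dvd_mul_right _ _)
    rw [mul_right_comm]
    exact ha.mul_right _
  rw [hq'] at h1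
  obtain ⟨w, rfl⟩ := (mul_dvd_mul_iff_left hg0).1 h1
  refine ⟨Ideal.Quotient.mk _ w, ?_⟩
  refine Ideal.Quotient.eq.2 ?_
  rw [← mul_sub, Ideal.mem_span_singleton]
  have h2 : (Ideal.Quotient.mk (Ideal.span {g}) w).out - w ∈ Ideal.span {g} :=
    Ideal.Quotient.eq.1 (Quotient.out_eq _)
  rw [Ideal.mem_span_singleton] at h2
  conv_lhs => rw [hq', mul_comm]
  exact mul_dvd_mul_left _ h2

lemma mem_Bq_iff (q r : GaussianInt) :
    r ∈ Bq q ↔ 0 ≤ (r * star q).re ∧ (r * star q).re < Zsqrtd.norm q ∧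
      0 ≤ (r * star q).im ∧ (r * star q).im < Zsqrtd.norm q := by
  have h1 : cip (toComplex r) (toComplex q) = ((r * star q).re : ℝ) := by
    simp only [cip, ← GaussianInt.intCast_re, ← GaussianInt.intCast_im, Zsqrtd.re_mul,
      Zsqrtd.re_star, Zsqrtd.im_star]
    push_cast
    ring
  have h2 : cip (toComplex r) (Complex.I * toComplex q) = ((r * star q).im : ℝ) := by
    simp only [cip, Complex.I_mul_re, Complex.I_mul_im, ← GaussianInt.intCast_re,
      ← GaussianInt.intCast_im, Zsqrtd.im_mul, Zsqrtd.re_star, Zsqrtd.im_star]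
    push_cast
    ring
  have h3 : Complex.normSq (toComplex q) = (Zsqrtd.norm q : ℝ) := by
    simp only [Complex.normSq_apply, ← GaussianInt.intCast_re, ← GaussianInt.intCast_im,
      Zsqrtd.norm_def]
    push_cast
    ring
  rw [Bq, Set.mem_ofPred_eq, h1, h2, h3]
  norm_cast

lemma norm_pos_of_ne_zero {q : GaussianInt} (hq : q ≠ 0) : 0 < Zsqrtd.norm q :=
  GaussianInt.norm_pos.2 hq

lemma exists_mem_Bq_dvd_sub {q : GaussianInt} (hq : q ≠ 0) (z : GaussianInt) :
    ∃ r ∈ Bq q, q ∣ z - r := by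
  have hN := norm_pos_of_ne_zero hq
  let w := z * star q
  let k : GaussianInt := ⟨w.re / Zsqrtd.norm q, w.im / Zsqrtd.norm q⟩
  have hw : (z - q * k) * star q = w - (Zsqrtd.norm q : GaussianInt) * k := by
    rw [Zsqrtd.norm_eq_mul_conj]
    ring
  refine ⟨z - q * k, ?_, by rw [sub_sub_cancel]; exact dvd_mul_right _ _⟩
  have hre : ((z - q * k) * star q).re = w.re % Zsqrtd.norm q := by
    rw [hw, Int.emod_def]; simp [k]
  have him : ((z - q * k) * star q).im = w.im % Zsqrtd.norm q := by
    rw [hw, Int.emod_def]; simp [k]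
  rw [mem_Bq_iff, hre, him]
  exact ⟨Int.emod_nonneg _ hN.ne', Int.emod_lt_of_pos _ hN, Int.emod_nonneg _ hN.ne',
    Int.emod_lt_of_pos _ hN⟩

lemma eq_of_mem_Bq_of_dvd_sub {q r s : GaussianInt} (hq : q ≠ 0) (hr : r ∈ Bq q) (hs : s ∈ Bq q)
    (h : q ∣ r - s) : r = s := by
  have hN := norm_pos_of_ne_zero hq
  obtain ⟨k, hk⟩ := h
  rw [mem_Bq_iff] at hr hs
  have hw : r * star q - s * star q = (Zsqrtd.norm q : GaussianInt) * k := by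
    rw [← sub_mul, hk, Zsqrtd.norm_eq_mul_conj]
    ring
  have hzero : ∀ a b c : ℤ, 0 ≤ a → a < Zsqrtd.norm q → 0 ≤ b → b < Zsqrtd.norm q →
      a - b = Zsqrtd.norm q * c → c = 0 := by
    intro a b c ha ha' hb hb' h
    have h1 : c < 1 := by nlinarith
    have h2 : -1 < c := by nlinarith
    omega
  have hre : k.re = 0 := hzero _ _ _ hr.1 hr.2.1 hs.1 hs.2.1 (by
    have := congrArg Zsqrtd.re hw
    simpa using this)
  have him : k.im = 0 := hzero _ _ _ hr.2.2.1 hr.2.2.2 hs.2.2.1 hs.2.2.2 (by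
    have := congrArg Zsqrtd.im hw
    simpa using this)
  have hk0 : k = 0 := by ext <;> simp [hre, him]
  rw [hk0, mul_zero] at hk
  exact sub_eq_zero.1 hk

/-- Summing over the reduced residues `𝔸_q` is summing over the units of any model of `ℤ[i]/q`. -/
lemma tsum_Aq_eq_sum_units {q : GaussianInt} (hq : q ≠ 0) {R : Type*} [CommRing R] [Fintype R]
    (φ : GaussianInt →+* R) (hφ : Function.Surjective φ) (hker : ∀ z, φ z = 0 ↔ q ∣ z)
    (f : R → ℂ) : ∑' r : Aq q, f (φ r) = ∑ u : Rˣ, f u := by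
  have hunit : ∀ z, IsUnit (EuclideanDomain.gcd z q) ↔ IsUnit (φ z) := by
    intro z
    rw [EuclideanDomain.gcd_isUnit_iff]
    constructor
    · rintro ⟨a, b, hab⟩
      have := congrArg φ hab
      rw [map_add, map_mul, map_mul, (hker q).2 dvd_rfl, mul_zero, add_zero, map_one] at this
      exact IsUnit.of_mul_eq_one_right _ this
    · intro h
      obtain ⟨v, hv⟩ := h.exists_left_inv
      obtain ⟨a, rfl⟩ := hφ v
      have : q ∣ 1 - a * z := by
        rw [← hker, map_sub, map_mul, hv, map_one, sub_self]
      obtain ⟨b, hb⟩ := this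
      exact ⟨a, b, by rw [mul_comm b q, ← hb]; ring⟩
  let g : Aq q → Rˣ := fun r => ((hunit r).1 r.2.2).unit
  have hg : Function.Bijective g := by
    constructor
    · intro r s h
      have h1 : φ r = φ s := congrArg Units.val h
      refine Subtype.ext (eq_of_mem_Bq_of_dvd_sub hq r.2.1 s.2.1 ?_)
      rw [← hker, map_sub, h1, sub_self]
    · intro u
      obtain ⟨z, hz⟩ := hφ u
      obtain ⟨r, hr, hd⟩ := exists_mem_Bq_dvd_sub hq z
      have h1 : φ r = u := by
        rw [← hker, map_sub, sub_eq_zero] at hd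
        rw [← hd, hz]
      exact ⟨⟨r, hr, (hunit r).2 (h1 ▸ u.isUnit)⟩, Units.ext h1⟩
  rw [← tsum_fintype (L := .unconditional _), ← (Equiv.ofBijective g hg).tsum_eq]
  rfl

lemma e2_add (s t : ℝ) : e2 (s + t) = e2 s * e2 t := by
  rw [e2, e2, e2, ← Complex.exp_add]
  push_cast
  ring_nf

lemma e2_eq_one_iff (t : ℝ) : e2 t = 1 ↔ ∃ n : ℤ, t = n := by
  rw [e2, Complex.exp_eq_one_iff]
  refine exists_congr fun n => ?_
  have h : (2 * Real.pi * Complex.I : ℂ) ≠ 0 := Complex.two_pi_I_ne_zero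
  rw [mul_comm (n : ℂ), mul_right_inj' h]
  norm_cast

/-- There is a primitive additive character of `ℤ[i]/q` which sends the class of `z` to
`e(Re (z / q))`. -/
lemma exists_primitive_addChar_quotient {q : GaussianInt} (hq : q ≠ 0) :
    ∃ ψ : AddChar (GaussianInt ⧸ Ideal.span {q}) ℂ,
      (∀ z : GaussianInt, ψ (Ideal.Quotient.mk _ z) = e2 (toComplex z / toComplex q).re) ∧
      ∀ a, (∀ b, ψ (a * b) = 1) → a = 0 := by
  have hq' : toComplex q ≠ 0 := by rwa [Ne, toComplex_eq_zero]
  let χ : AddChar GaussianInt ℂ :=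
    { toFun := fun z => e2 (toComplex z / toComplex q).re
      map_zero_eq_one' := by simp [e2]
      map_add_eq_mul' := fun z w => by rw [map_add, add_div, Complex.add_re, e2_add] }
  obtain ⟨ψ, hψ⟩ := exists_addChar_lift_of_surjective
    (Ideal.Quotient.mk (Ideal.span {q})).toAddMonoidHom Ideal.Quotient.mk_surjective χ (by
      intro z hz
      obtain ⟨k, rfl⟩ := Ideal.mem_span_singleton.1 (Ideal.Quotient.eq_zero_iff_mem.1 hz)
      refine (e2_eq_one_iff _).2 ⟨k.re, ?_⟩
      rw [map_mul, mul_div_cancel_left₀ _ hq', ← GaussianInt.intCast_re])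
  replace hψ : ∀ z : GaussianInt, ψ (Ideal.Quotient.mk _ z) = e2 (toComplex z / toComplex q).re :=
    fun z => (hψ z).symm
  refine ⟨ψ, hψ, fun a ha => ?_⟩
  obtain ⟨z, rfl⟩ := Ideal.Quotient.mk_surjective a
  have hz : ∀ w : GaussianInt, ∃ n : ℤ, (toComplex (z * w) / toComplex q).re = n := fun w => by
    rw [← e2_eq_one_iff, ← hψ, map_mul, ha]
  obtain ⟨m, hm⟩ := hz 1
  obtain ⟨n, hn⟩ := hz ⟨0, -1⟩
  rw [mul_one] at hm
  have hn' : (toComplex z / toComplex q).im = n := by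
    rw [← hn, map_mul, mul_div_right_comm, toComplex_def' 0 (-1), Complex.mul_re]
    simp
  rw [Ideal.Quotient.eq_zero_iff_mem, Ideal.mem_span_singleton]
  refine ⟨⟨m, n⟩, toComplex_injective ?_⟩
  have : toComplex z / toComplex q = toComplex ⟨m, n⟩ :=
    Complex.ext (by rw [hm, re_toComplex]) (by rw [hn', im_toComplex])
  rw [map_mul, ← this, mul_div_cancel₀ _ hq']

lemma cip_div_eq_re (x n q : GaussianInt) :
    cip (toComplex x) (toComplex n / toComplex q)
      = (toComplex (star x * n) / toComplex q).re := by
  rw [map_mul, toComplex_star, mul_div_assoc, Complex.mul_re]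
  simp [cip]

theorem cohen_sum_bound (ε : ℝ) (hε : 0 < ε) :
    ∃ C : ℝ, ∀ q : GaussianInt, q ≠ 0 → ∀ x : GaussianInt,
      ‖∑' r : Aq (star q), gtau q (x + (r : GaussianInt))‖
        ≤ C * (Zsqrtd.norm (EuclideanDomain.gcd (star x) q) : ℝ) * (Zsqrtd.norm q : ℝ) ^ ε := by
  refine ⟨1, fun q hq x => ?_⟩
  have := finite_quotient_span_gaussianInt hq
  let := Fintype.ofFinite (GaussianInt ⧸ Ideal.span {q})
  obtain ⟨ψ, hψ, hprim⟩ := exists_primitive_addChar_quotient hq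
  let κ := Ideal.Quotient.mk (Ideal.span {q})
  have hκ : ∀ z, κ z = 0 ↔ q ∣ z := fun z => by
    rw [Ideal.Quotient.eq_zero_iff_mem, Ideal.mem_span_singleton]
  have hstar : ∀ z w : GaussianInt, z ∣ star w ↔ star z ∣ w := fun z w =>
    ⟨fun h => by simpa [starRingEnd_apply] using map_dvd (starRingEnd GaussianInt) h,
      fun h => by simpa [starRingEnd_apply] using map_dvd (starRingEnd GaussianInt) h⟩
  have htau : ∀ y, gtau q y = ∑ u : (GaussianInt ⧸ Ideal.span {q})ˣ, ψ (κ (star y) * u) := by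
    intro y
    rw [← tsum_Aq_eq_sum_units hq κ Ideal.Quotient.mk_surjective hκ
      (fun r => ψ (κ (star y) * r)), gtau]
    refine tsum_congr fun n => ?_
    rw [← map_mul, hψ, cip_div_eq_re]
  have hprod : ∑' r : Aq (star q), gtau q (x + (r : GaussianInt))
      = (∑ u : (GaussianInt ⧸ Ideal.span {q})ˣ, ψ (κ (star x) * u))
        * ∑ v : (GaussianInt ⧸ Ideal.span {q})ˣ, ψ v := by
    have h1 : ∀ r : Aq (star q), gtau q (x + (r : GaussianInt))
        = ∑ u : (GaussianInt ⧸ Ideal.span {q})ˣ,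
          ψ ((κ (star x) + (κ.comp (starRingEnd GaussianInt)) r) * u) := by
      intro r
      rw [htau, star_add, map_add]
      rfl
    rw [tsum_congr h1, tsum_Aq_eq_sum_units (star_ne_zero.2 hq) (κ.comp (starRingEnd GaussianInt))
      (Ideal.Quotient.mk_surjective.comp (star_involutive).surjective)
      (fun z => (hκ (star z)).trans (hstar q z))
      (fun r => ∑ u : (GaussianInt ⧸ Ideal.span {q})ˣ, ψ ((κ (star x) + r) * u)),
      Finset.sum_comm, Finset.sum_mul]
    refine Finset.sum_congr rfl fun u _ => ?_
    rw [Finset.mul_sum]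
    refine Fintype.sum_equiv (Equiv.mulRight u) _ _ fun v => ?_
    rw [add_mul, AddChar.map_add_eq_mul, Equiv.coe_mulRight, Units.val_mul]
  have hone : ‖∑ v : (GaussianInt ⧸ Ideal.span {q})ˣ, ψ v‖ ≤ 1 := by
    refine (norm_sum_units_addChar_le ψ).trans ?_
    have : Subsingleton {a : GaussianInt ⧸ Ideal.span {q} // ∀ b, ψ (a * b) = 1} :=
      ⟨fun a b => Subtype.ext ((hprim _ a.2).trans (hprim _ b.2).symm)⟩
    exact_mod_cast Finite.card_le_one_iff_subsingleton.2 this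
  have hann : ‖∑ u : (GaussianInt ⧸ Ideal.span {q})ˣ, ψ (κ (star x) * u)‖
      ≤ (Zsqrtd.norm (EuclideanDomain.gcd (star x) q) : ℝ) := by
    refine (norm_sum_units_addChar_le (ψ.mulShift (κ (star x)))).trans ?_
    refine le_trans (b := ((Nat.card {a // κ (star x) * a = 0} : ℤ) : ℝ)) ?_
      (Int.cast_le.2 (card_annihilator_le hq (star x)))
    rw [Int.cast_natCast, Nat.cast_le]
    refine Nat.card_mono (Set.toFinite {a | κ (star x) * a = 0}) fun a ha => hprim _ fun b => ?_
    rw [mul_assoc]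
    exact ha b
  have hpow : (1 : ℝ) ≤ (Zsqrtd.norm q : ℝ) ^ ε :=
    Real.one_le_rpow (by exact_mod_cast norm_pos_of_ne_zero hq) hε.le
  rw [hprod, norm_mul, one_mul]
  exact mul_le_mul hann (hone.trans hpow) (_root_.norm_nonneg _)
    (Int.cast_nonneg (GaussianInt.norm_nonneg _))

end
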